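/- Let p be a prime, a and n positive integers, r an integer, and j a non-negative integer. Define S_j(n, r, p^a) as the sum, over all p^a-tuples (i_0, i_1, ..., i_{p^a - 1}) of non-negative integers with i_0 + i_1 + ⋯ + i_{p^a - 1} = n and i_1 + 2i_2 + ⋯ + (p^a - 1)i_{p^a - 1} ≡ r (mod p^a), of the multinomial coefficient n!/(i_0! ⋯ i_{p^a - 1}!) times C((i_1 + 2i_2 + ⋯ + (p^a - 1)i_{p^a - 1} - r)/p^a, j). Then S_j(n, r, p^a) is divisible by p^[((an - a + 1)(p-1) - j(ap - a + 1) - 1)/(p-1)]. -/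

import Mathlib

open Polynomial in
theorem msc_exists_u (p : ℕ) (hp : p.Prime) {R : Type*} [CommRing R] (x : R) :
    ∃ u : R, ∑ k ∈ Finset.range p, x ^ k = p * u + (x - 1) ^ (p - 1) := by
  obtain ⟨s, hs⟩ := exists_add_pow_prime_eq hp (X - 1 : ℤ[X]) 1
  have h1 : (X - 1 : ℤ[X]) * ∑ k ∈ Finset.range p, (X : ℤ[X]) ^ k
      = (X - 1) * ((p : ℤ[X]) * s + (X - 1) ^ (p - 1)) := by
    rw [mul_geom_sum]
    have : (X - 1 : ℤ[X]) ^ p = (X - 1) * (X - 1) ^ (p - 1) := by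
      rw [← pow_succ', Nat.sub_add_cancel hp.one_lt.le]
    rw [mul_add, ← this]
    simp only [sub_add_cancel, one_pow, mul_one] at hs
    rw [hs]; ring
  have hX : (X - 1 : ℤ[X]) ≠ 0 := by
    simpa using X_sub_C_ne_zero (1 : ℤ)
  have h2 := mul_left_cancel₀ hX h1
  refine ⟨aeval x s, ?_⟩
  have h3 := congrArg (aeval x) h2
  simpa using h3

/-- the weighted ideal -/
def mscK (p a n : ℕ) {R : Type*} [CommRing R] (w : R) : Ideal R :=
  Ideal.span {y | ∃ i j : ℕ, j ≤ n ∧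
    (p - 1) * a * n ≤ (p - 1) * i + j * ((p - 1) * a + 1) + (p - 1) * a ∧
    y = (p : R) ^ i * w ^ j}

theorem mscK_red (p n : ℕ) (hp : p.Prime) {R : Type*} [CommRing R] (z w u : R)
    (h : z ^ p = w - p * u * z) :
    ∀ k i j : ℕ, (p - 1) * n ≤ (p - 1) * i + k + j * p →
      (p : R) ^ i * z ^ k * w ^ j ∈ mscK p 1 n w := by
  obtain ⟨d, rfl⟩ : ∃ d, p = d + 1 := ⟨p - 1, by have := hp.one_lt; omega⟩
  have hd : 0 < d := by have := hp.one_lt; omega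
  intro k
  induction k using Nat.strong_induction_on with
  | _ k ih =>
    intro i j hij
    simp only [Nat.add_sub_cancel] at hij ih
    by_cases hk : k < d + 1
    · by_cases hj : j ≤ n
      · have : ((d + 1 : ℕ) : R) ^ i * w ^ j ∈ mscK (d + 1) 1 n w := by
          refine Ideal.subset_span ⟨i, j, hj, ?_, rfl⟩
          simp only [Nat.add_sub_cancel, mul_one]
          omega
        convert Ideal.mul_mem_left _ (z ^ k) this using 1
        ring
      · have : ((d + 1 : ℕ) : R) ^ 0 * w ^ n ∈ mscK (d + 1) 1 n w := by
          refine Ideal.subset_span ⟨0, n, le_rfl, ?_, rfl⟩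
          simp only [Nat.add_sub_cancel, mul_one]
          nlinarith
        convert Ideal.mul_mem_left _ (((d + 1 : ℕ) : R) ^ i * z ^ k * w ^ (j - n)) this using 1
        obtain ⟨e, rfl⟩ : ∃ e, j = n + e := ⟨j - n, by omega⟩
        simp only [Nat.add_sub_cancel_left]
        ring
    · obtain ⟨e, rfl⟩ : ∃ e, k = e + (d + 1) := ⟨k - (d + 1), by omega⟩
      have h1 := ih e (by omega) i (j + 1) (by nlinarith)
      have h2 := ih (e + 1) (by omega) (i + 1) j (by nlinarith)
      have h3 := Ideal.sub_mem _ h1 (Ideal.mul_mem_left _ u h2)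
      convert h3 using 1
      rw [pow_add z e, h]
      ring

theorem msc_base (p n : ℕ) (hp : p.Prime) {R : Type*} [CommRing R] (x : R) :
    (∑ k ∈ Finset.range p, x ^ k) ^ n ∈ mscK p 1 n (x ^ p - 1) := by
  obtain ⟨u, hu⟩ := msc_exists_u p hp x
  have hz : (x - 1) ^ p = (x ^ p - 1) - p * u * (x - 1) := by
    rw [← mul_geom_sum, hu]
    have : (x - 1) ^ p = (x - 1) * (x - 1) ^ (p - 1) := by
      rw [← pow_succ', Nat.sub_add_cancel hp.one_lt.le]
    rw [this]; ring
  rw [hu, add_pow]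
  refine Ideal.sum_mem _ fun m hm => ?_
  have hm' : m ≤ n := by simpa [Nat.lt_succ_iff] using hm
  obtain ⟨e, rfl⟩ : ∃ e, n = m + e := ⟨n - m, by omega⟩
  have := mscK_red p (m + e) hp (x - 1) (x ^ p - 1) u hz ((p - 1) * e) m 0 (by
    rw [mul_add]; omega)
  convert Ideal.mul_mem_left _ (u ^ m * ((m + e).choose m : R)) this using 1
  rw [Nat.add_sub_cancel_left, ← pow_mul]
  ring

theorem msc_main (p : ℕ) (hp : p.Prime) {R : Type*} [CommRing R] (a : ℕ) :
    ∀ (n : ℕ) (x : R),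
    (∑ k ∈ Finset.range (p ^ a), x ^ k) ^ n ∈ mscK p a n (x ^ (p ^ a) - 1) := by
  induction a with
  | zero =>
    intro n x
    refine Ideal.subset_span ⟨0, 0, by simp, by simp, by simp⟩
  | succ a ih =>
    intro n x
    have hfac : ∑ k ∈ Finset.range (p ^ (a + 1)), x ^ k =
        (∑ k ∈ Finset.range p, x ^ k) * ∑ k ∈ Finset.range (p ^ a), (x ^ p) ^ k := by
      rw [pow_succ']
      generalize p ^ a = m
      induction m with
      | zero => simp
      | succ m ihm =>
        rw [Finset.sum_range_succ, Nat.mul_succ, Finset.sum_range_add, ihm, mul_add (∑ k ∈ Finset.range p, x ^ k),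
          Finset.sum_mul _ _ ((x ^ p) ^ m)]
        congr 1
        refine Finset.sum_congr rfl fun k _ => ?_
        rw [← pow_mul]; ring
    have hw : x ^ (p ^ (a + 1)) - 1 = (x ^ p - 1) * ∑ k ∈ Finset.range (p ^ a), (x ^ p) ^ k := by
      rw [mul_geom_sum, ← pow_mul, pow_succ']
    have hw' : x ^ (p ^ (a + 1)) - 1 = (x ^ p) ^ (p ^ a) - 1 := by
      rw [← pow_mul, pow_succ']
    rw [hfac, mul_pow]
    generalize hΨ : ∑ k ∈ Finset.range (p ^ a), (x ^ p) ^ k = Ψ at *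
    have hb := msc_base p n hp x
    have key : ∀ y ∈ mscK p 1 n (x ^ p - 1), y * Ψ ^ n ∈ mscK p (a + 1) n (x ^ (p ^ (a + 1)) - 1) := by
      intro y hy
      refine Submodule.span_induction (p := fun y _ => y * Ψ ^ n ∈ mscK p (a + 1) n (x ^ (p ^ (a + 1)) - 1))
        ?_ ?_ ?_ ?_ hy
      · rintro _ ⟨i, j, hj, hij, rfl⟩
        obtain ⟨m, rfl⟩ : ∃ m, n = j + m := ⟨n - j, by omega⟩
        have h1 : (p : R) ^ i * (x ^ p - 1) ^ j * Ψ ^ (j + m)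
            = (p : R) ^ i * (x ^ (p ^ (a + 1)) - 1) ^ j * Ψ ^ m := by
          rw [hw, mul_pow, pow_add]; ring
        rw [h1]
        have h2 := ih m (x ^ p)
        rw [hΨ, ← hw'] at h2
        refine Submodule.span_induction (p := fun y _ => (p : R) ^ i * (x ^ (p ^ (a + 1)) - 1) ^ j * y
          ∈ mscK p (a + 1) (j + m) (x ^ (p ^ (a + 1)) - 1)) ?_ ?_ ?_ ?_ h2
        · rintro _ ⟨i', j', hj', hij', rfl⟩
          refine Ideal.subset_span ⟨i + i', j + j', by omega, ?_, by ring⟩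
          generalize p - 1 = d at *
          nlinarith [Nat.zero_le (d * j')]
        · simp
        · intro y z _ _ h1 h2
          rw [mul_add]; exact Ideal.add_mem _ h1 h2
        · intro c y _ h1
          convert Ideal.mul_mem_left _ c h1 using 1
          simp only [smul_eq_mul]; ring
      · simp
      · intro y z _ _ h1 h2
        rw [add_mul]; exact Ideal.add_mem _ h1 h2
      · intro c y _ h1
        convert Ideal.mul_mem_left _ c h1 using 1
        simp only [smul_eq_mul]; ring
    exact key _ hb

open Polynomial in
/-- the coefficient functional -/
noncomputable def mscT (q : ℕ) (r : ℤ) (j : ℕ) : ℤ[X] →ₗ[ℤ] ℤ :=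
  Polynomial.lsum fun k : ℕ =>
    (if (k : ℤ) ≡ r [ZMOD (q : ℤ)] then Ring.choose (((k : ℤ) - r) / (q : ℤ)) j else 0) •
      (LinearMap.id : ℤ →ₗ[ℤ] ℤ)

open Polynomial in
theorem mscT_pow (q : ℕ) (r : ℤ) (j k : ℕ) : mscT q r j (X ^ k) =
    if (k : ℤ) ≡ r [ZMOD (q : ℤ)] then Ring.choose (((k : ℤ) - r) / (q : ℤ)) j else 0 := by
  rw [mscT, Polynomial.lsum_apply, ← monomial_one_right_eq_X_pow, sum_monomial_index]
  · split_ifs <;> simp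
  · simp

open Polynomial in
theorem mscT_w_zero (q : ℕ) (hq : 0 < q) (r : ℤ) (f : ℤ[X]) :
    mscT q r 0 ((X ^ q - 1) * f) = 0 := by
  suffices h : (mscT q r 0) ∘ₗ (LinearMap.mulLeft ℤ (X ^ q - 1 : ℤ[X])) = 0 from
    LinearMap.congr_fun h f
  refine Polynomial.lhom_ext' fun k => LinearMap.ext_ring ?_
  simp only [LinearMap.comp_apply, LinearMap.mulLeft_apply, monomial_one_right_eq_X_pow,
    sub_mul, ← pow_add, one_mul, map_sub, mscT_pow, LinearMap.zero_apply, Ring.choose_zero_right]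
  have : (((q + k : ℕ) : ℤ) ≡ r [ZMOD (q : ℤ)]) ↔ ((k : ℤ) ≡ r [ZMOD (q : ℤ)]) := by
    simp [Int.ModEq]
  simp [this]

open Polynomial in
theorem mscT_w_succ (q : ℕ) (hq : 0 < q) (r : ℤ) (j : ℕ) (f : ℤ[X]) :
    mscT q r (j + 1) ((X ^ q - 1) * f) = mscT q r j f := by
  suffices h : (mscT q r (j + 1)) ∘ₗ (LinearMap.mulLeft ℤ (X ^ q - 1 : ℤ[X])) = mscT q r j from
    LinearMap.congr_fun h f
  refine Polynomial.lhom_ext' fun k => LinearMap.ext_ring ?_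
  simp only [LinearMap.comp_apply, LinearMap.mulLeft_apply, monomial_one_right_eq_X_pow,
    sub_mul, ← pow_add, one_mul, map_sub, mscT_pow]
  have : (((q + k : ℕ) : ℤ) ≡ r [ZMOD (q : ℤ)]) ↔ ((k : ℤ) ≡ r [ZMOD (q : ℤ)]) := by
    simp [Int.ModEq]
  simp only [this]
  split_ifs with h
  · have h2 : (((q + k : ℕ) : ℤ) - r) / (q : ℤ) = ((k : ℤ) - r) / q + 1 := by
      have h3 : (((q + k : ℕ) : ℤ) - r) = ((k : ℤ) - r) + 1 * q := by push_cast; ring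
      rw [h3, Int.add_mul_ediv_right _ _ (by exact_mod_cast hq.ne')]
    rw [h2, Ring.choose_succ_succ]
    ring
  · simp

open Polynomial in
theorem mscT_w_pow (q : ℕ) (hq : 0 < q) (r : ℤ) (e : ℕ) (c : ℤ) : ∀ (l j : ℕ) (f : ℤ[X]),
    (l ≤ j → (c ∣ (e : ℤ))) → c ∣ mscT q r j ((e : ℤ[X]) * (X ^ q - 1) ^ l * f) := by
  intro l
  induction l with
  | zero =>
    intro j f h
    have : (e : ℤ[X]) * (X ^ q - 1) ^ 0 * f = (e : ℤ) • f := by simp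
    rw [this, map_smul, smul_eq_mul]
    exact Dvd.dvd.mul_right (h (Nat.zero_le _)) _
  | succ l ih =>
    intro j f h
    have : (e : ℤ[X]) * (X ^ q - 1) ^ (l + 1) * f =
      (X ^ q - 1) * ((e : ℤ[X]) * (X ^ q - 1) ^ l * f) := by ring
    rw [this]
    cases j with
    | zero => rw [mscT_w_zero q hq]; exact dvd_zero _
    | succ j =>
      rw [mscT_w_succ q hq]
      exact ih j f fun hl => h (by omega)



/-- **Sharp Congruence II for `ψ^a`** (Theorem 1.4).  For a prime `p`, positive integers
`a` and `n`, an integer `r` and `j ≥ 0`, the sum `S_j(n, r, p^a)` over all `p^a`-tuples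
`(i₀, …, i_{p^a-1})` of non-negative integers with `i₀ + ⋯ + i_{p^a-1} = n` and
`i₁ + 2i₂ + ⋯ ≡ r (mod p^a)` of `(n choose i₀ … i_{p^a-1}) · C((i₁ + 2i₂ + ⋯ - r)/p^a, j)`
is divisible by `p^[((an-a+1)(p-1)-j(ap-a+1)-1)/(p-1)]`, where `[x]` is the floor of `x`
when `x ≥ 0` and `0` otherwise. -/
theorem multinomial_sharp_congruence_prime_power (p : ℕ) (hp : p.Prime) (a n : ℕ)
    (ha : 0 < a) (hn : 0 < n) (r : ℤ) (j : ℕ) :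
    (p : ℤ) ^ (((((a : ℤ) * n - a + 1) * ((p : ℤ) - 1) - j * ((a : ℤ) * p - a + 1) - 1) /
        ((p : ℤ) - 1)).toNat) ∣
      ∑ i ∈ (Finset.Nat.antidiagonalTuple (p ^ a) n).filter
          (fun i : Fin (p ^ a) → ℕ =>
            (∑ t : Fin (p ^ a), (t : ℤ) * (i t : ℤ)) ≡ r [ZMOD ((p : ℤ) ^ a)]),
        (Nat.multinomial Finset.univ i : ℤ) *
          Ring.choose (((∑ t : Fin (p ^ a), (t : ℤ) * (i t : ℤ)) - r) / (p : ℤ) ^ a) j := by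
  classical
  have hq : 0 < p ^ a := pow_pos hp.pos a
  have hS : (∑ i ∈ (Finset.Nat.antidiagonalTuple (p ^ a) n).filter
          (fun i : Fin (p ^ a) → ℕ =>
            (∑ t : Fin (p ^ a), (t : ℤ) * (i t : ℤ)) ≡ r [ZMOD ((p : ℤ) ^ a)]),
        (Nat.multinomial Finset.univ i : ℤ) *
          Ring.choose (((∑ t : Fin (p ^ a), (t : ℤ) * (i t : ℤ)) - r) / (p : ℤ) ^ a) j)
      = mscT (p ^ a) r j ((∑ k ∈ Finset.range (p ^ a), (Polynomial.X : Polynomial ℤ) ^ k) ^ n) := by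
    rw [Finset.sum_range, Finset.sum_pow_eq_sum_piAntidiag,
      Finset.piAntidiag_univ_fin_eq_antidiagonalTuple, map_sum, Finset.sum_filter]
    refine Finset.sum_congr rfl fun i _ => ?_
    have : (Nat.multinomial Finset.univ i : Polynomial ℤ) *
        ∏ t : Fin (p ^ a), ((Polynomial.X : Polynomial ℤ) ^ (t : ℕ)) ^ i t
        = (Nat.multinomial Finset.univ i : ℤ) •
          (Polynomial.X : Polynomial ℤ) ^ (∑ t : Fin (p ^ a), (t : ℕ) * i t) := by
      simp [← pow_mul, Finset.prod_pow_eq_pow_sum]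
    rw [this, map_smul, mscT_pow]
    push_cast
    split_ifs <;> simp
  rw [hS]
  have hK := msc_main p hp a n (Polynomial.X : Polynomial ℤ)
  generalize (∑ k ∈ Finset.range (p ^ a), (Polynomial.X : Polynomial ℤ) ^ k) ^ n = F at hK
  have gen : ∀ f, (p : ℤ) ^ (((((a : ℤ) * n - a + 1) * ((p : ℤ) - 1) -
      j * ((a : ℤ) * p - a + 1) - 1) / ((p : ℤ) - 1)).toNat) ∣ mscT (p ^ a) r j (f * F) := by
    refine Submodule.span_induction (p := fun F _ => ∀ f, (p : ℤ) ^ (((((a : ℤ) * n - a + 1) *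
      ((p : ℤ) - 1) - j * ((a : ℤ) * p - a + 1) - 1) / ((p : ℤ) - 1)).toNat) ∣
      mscT (p ^ a) r j (f * F)) ?_ ?_ ?_ ?_ hK
    · rintro _ ⟨i, l, hl, hil, rfl⟩ f
      rw [mul_comm f]
      have := mscT_w_pow (p ^ a) hq r (p ^ i) ((p : ℤ) ^ (((((a : ℤ) * n - a + 1) *
        ((p : ℤ) - 1) - j * ((a : ℤ) * p - a + 1) - 1) / ((p : ℤ) - 1)).toNat)) l j f
      rw [Nat.cast_pow, Nat.cast_pow] at this
      refine this fun hlj => pow_dvd_pow _ ?_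
      rw [Int.toNat_le, ← Int.lt_add_one_iff]
      obtain ⟨d, rfl⟩ : ∃ d, p = d + 1 := ⟨p - 1, by have := hp.one_lt; omega⟩
      have hd : 0 < d := by have := hp.one_lt; omega
      simp only [Nat.add_sub_cancel] at hil
      have hmul : l * (d * a + 1) ≤ j * (d * a + 1) := Nat.mul_le_mul_right _ hlj
      zify at hil hmul
      push_cast
      apply Int.ediv_lt_of_lt_mul
      · simpa using hd
      · nlinarith
    · simp
    · intro y z _ _ h1 h2 f
      rw [mul_add f, map_add]; exact dvd_add (h1 f) (h2 f)
    · intro c y _ h1 f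
      rw [smul_eq_mul, ← mul_assoc]; exact h1 _
  simpa using gen 1
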